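/- Let d be a positive integer, let r > 0, and let X_1, X_2, …, X_d be sets in ℝ^d such that B_r(0) ⊆ conv(X_i) for every i = 1, …, d. Then for every v ∈ ℝ^d there exist points x_1 ∈ X_1, …, x_d ∈ X_d and nonnegative reals λ_1, …, λ_d such that v = λ_1·x_1 + … + λ_d·x_d. In other words, the simplicial cones spanned by colorful choices x_1 ∈ X_1, …, x_d ∈ X_d cover ℝ^d. -/

import Mathlib

/-- The convex cone of nonnegative combinations of the vectors `x i`, `i ∈ s`. -/
def nonnegSpan {ι E : Type*} [AddCommGroup E] [Module ℝ E] (x : ι → E) (s : Finset ι) : Set E :=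
  {p | ∃ l : ι → ℝ, (∀ i, 0 ≤ l i) ∧ p = ∑ i ∈ s, l i • x i}

/-- A nonnegative combination of linearly dependent vectors can be rewritten so that one of the
coefficients vanishes. -/
theorem exists_nonneg_combination_eq_zero {ι E : Type*} [AddCommGroup E] [Module ℝ E] {x : ι → E}
    {s : Finset ι} (h : ¬ LinearIndepOn ℝ x (s : Set ι)) {l : ι → ℝ} (hl : ∀ i, 0 ≤ l i) :
    ∃ m : ι → ℝ, (∀ i ∈ s, 0 ≤ m i) ∧ (∃ j ∈ s, m j = 0) ∧
      ∑ i ∈ s, l i • x i = ∑ i ∈ s, m i • x i := by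
  obtain ⟨g, hg, hpos⟩ : ∃ g : ι → ℝ, ∑ i ∈ s, g i • x i = 0 ∧ ∃ i ∈ s, 0 < g i := by
    rw [linearIndepOn_finset_iff] at h
    push Not at h
    obtain ⟨g, hg, i, hi, hne⟩ := h
    rcases lt_or_gt_of_ne hne with hneg | hpos
    · exact ⟨-g, by simp [hg], i, hi, by simpa using hneg⟩
    · exact ⟨g, hg, i, hi, hpos⟩
  obtain ⟨k, hk, hgk⟩ := hpos
  obtain ⟨j, hj, hmin⟩ := (s.filter (0 < g ·)).exists_min_image (fun i => l i / g i)
    ⟨k, Finset.mem_filter.2 ⟨hk, hgk⟩⟩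
  obtain ⟨hjs, hgj⟩ := Finset.mem_filter.1 hj
  refine ⟨fun i => l i - l j / g j * g i, fun i hi => ?_, ⟨j, hjs, ?_⟩, ?_⟩
  · rcases lt_or_ge 0 (g i) with hgi | hgi
    · have := hmin i (Finset.mem_filter.2 ⟨hi, hgi⟩)
      rw [le_div_iff₀ hgi] at this
      linarith
    · have := mul_nonpos_of_nonneg_of_nonpos (div_nonneg (hl j) hgj.le) hgi
      linarith [hl i]
  · field_simp
    ring
  · simp only [sub_smul, mul_smul, Finset.sum_sub_distrib, ← Finset.smul_sum, hg, smul_zero,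
      sub_zero]

theorem nonnegSpan_mono {ι E : Type*} [AddCommGroup E] [Module ℝ E] (x : ι → E) {s t : Finset ι}
    (h : s ⊆ t) : nonnegSpan x s ⊆ nonnegSpan x t := by
  classical
  rintro _ ⟨l, hl, rfl⟩
  refine ⟨fun i => if i ∈ s then l i else 0, fun i => ?_, ?_⟩
  · dsimp only
    split_ifs
    exacts [hl i, le_rfl]
  · rw [← Finset.sum_subset h]
    · exact Finset.sum_congr rfl fun i hi => by simp [hi]
    · intro i _ hi
      simp [hi]

theorem isClosed_nonnegSpan {ι E : Type*} [NormedAddCommGroup E] [NormedSpace ℝ E] (x : ι → E)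
    (s : Finset ι) : IsClosed (nonnegSpan x s) := by
  classical
  induction s using Finset.strongInduction with
  | H s ih =>
    by_cases h : LinearIndepOn ℝ x (s : Set ι)
    · let f : (s → ℝ) →ₗ[ℝ] E := Fintype.linearCombination ℝ fun i : s => x i
      have hf : LinearMap.ker f = ⊥ := by
        rw [LinearMap.ker_eq_bot]
        exact linearIndependent_iff_injective_fintypeLinearCombination.1 h
      have himage : nonnegSpan x s = f '' Set.Ici 0 := by
        ext p
        constructor
        · rintro ⟨l, hl, rfl⟩
          refine ⟨fun i => l i, fun i => hl i, ?_⟩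
          simp only [f, Fintype.linearCombination_apply]
          exact Finset.sum_coe_sort s fun i => l i • x i
        · rintro ⟨l, hl, rfl⟩
          refine ⟨fun i => if hi : i ∈ s then l ⟨i, hi⟩ else 0, fun i => ?_, ?_⟩
          · dsimp only
            split_ifs
            exacts [hl _, le_rfl]
          · simp only [f, Fintype.linearCombination_apply]
            rw [← Finset.sum_coe_sort s]
            simp
      rw [himage]
      exact (LinearMap.isClosedEmbedding_of_injective hf).isClosedMap _ isClosed_Ici
    · have hunion : nonnegSpan x s = ⋃ j ∈ s, nonnegSpan x (s.erase j) := by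
        apply Set.Subset.antisymm
        · rintro _ ⟨l, hl, rfl⟩
          obtain ⟨m, hm, ⟨j, hj, hmj⟩, heq⟩ := exists_nonneg_combination_eq_zero h hl
          refine Set.mem_iUnion₂.2 ⟨j, hj, fun i => |m i|, fun i => abs_nonneg _, ?_⟩
          rw [heq, ← Finset.sum_erase s (a := j) (by simp [hmj])]
          exact Finset.sum_congr rfl fun i hi => by
            dsimp only
            rw [abs_of_nonneg (hm i (Finset.mem_of_mem_erase hi))]
        · exact Set.iUnion₂_subset fun j _ => nonnegSpan_mono x (Finset.erase_subset j s)
      rw [hunion]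
      exact s.finite_toSet.isClosed_biUnion fun j hj => ih _ (Finset.erase_ssubset hj)

/-- If `p` is a closest point to `v` on a segment from `p` in direction `y`, then `y` makes a
nonacute angle with `v - p`. -/
theorem inner_nonpos_of_forall_norm_sub_le {E : Type*} [NormedAddCommGroup E]
    [InnerProductSpace ℝ E] {v p y : E}
    (h : ∀ ε : ℝ, 0 ≤ ε → ε ≤ 1 → ‖v - p‖ ≤ ‖v - (p + ε • y)‖) : inner ℝ (v - p) y ≤ 0 := by
  by_contra! hpos
  set a := inner ℝ (v - p) y with ha
  set b := ‖y‖ ^ 2 with hb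
  have hb0 : 0 ≤ b := by positivity
  have hε : 0 < a / (a + b) := by positivity
  have hle := h (a / (a + b)) hε.le (by rw [div_le_one (by positivity)]; linarith)
  have hsq := pow_le_pow_left₀ (norm_nonneg _) hle 2
  rw [← sub_sub, norm_sub_sq_real (v - p), inner_smul_right, norm_smul, mul_pow, ← ha, ← hb,
    Real.norm_eq_abs, sq_abs] at hsq
  have hmul : a / (a + b) * (a + b) = a := by field_simp
  nlinarith

/-- The colorful Carathéodory theorem for cones: a point in the convex hull of each of at least
`finrank ℝ E` sets lies in the cone spanned by a colorful choice of points. -/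
theorem exists_colorful_nonneg_combination {ι E : Type*} [Fintype ι] [NormedAddCommGroup E]
    [InnerProductSpace ℝ E] [FiniteDimensional ℝ E] (hcard : Module.finrank ℝ E ≤ Fintype.card ι)
    (X : ι → Set E) {v : E} (hv : ∀ i, v ∈ convexHull ℝ (X i)) :
    ∃ (x : ι → E) (l : ι → ℝ), (∀ i, x i ∈ X i) ∧ (∀ i, 0 ≤ l i) ∧ v = ∑ i, l i • x i := by
  classical
  have hfin (i : ι) : ∃ t : Finset E, (t : Set E) ⊆ X i ∧ v ∈ convexHull ℝ (t : Set E) := by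
    have := hv i
    rw [convexHull_eq_union_convexHull_finite_subsets] at this
    simpa using this
  choose t htX hvt using hfin
  let C : Set E := ⋃ x ∈ Fintype.piFinset t, nonnegSpan x Finset.univ
  have hCclosed : IsClosed C :=
    (Fintype.piFinset t).finite_toSet.isClosed_biUnion fun x _ => isClosed_nonnegSpan x _
  have hCne : C.Nonempty := by
    choose x hx using fun i => convexHull_nonempty_iff.1 ⟨v, hvt i⟩
    exact ⟨0, Set.mem_iUnion₂.2 ⟨x, Fintype.mem_piFinset.2 hx, 0, fun _ => le_rfl, by simp⟩⟩
  obtain ⟨p, hpC, hdist⟩ := hCclosed.exists_infDist_eq_dist hCne v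
  have hmin : ∀ q ∈ C, ‖v - p‖ ≤ ‖v - q‖ := fun q hq => by
    rw [← dist_eq_norm, ← dist_eq_norm, ← hdist]
    exact Metric.infDist_le_dist_of_mem hq
  obtain ⟨x, hx, l, hl, hp⟩ := Set.mem_iUnion₂.1 hpC
  have hmem : ∀ m : ι → ℝ, (∀ i, 0 ≤ m i) → ∑ i, m i • x i ∈ C := fun m hm =>
    Set.mem_iUnion₂.2 ⟨x, hx, m, hm, rfl⟩
  by_cases hpv : v - p = 0
  · exact ⟨x, l, fun i => htX i (Fintype.mem_piFinset.1 hx i), hl, (sub_eq_zero.1 hpv).trans hp⟩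
  exfalso
  have hxle (i : ι) : inner ℝ (v - p) (x i) ≤ 0 := by
    refine inner_nonpos_of_forall_norm_sub_le fun ε hε _ => hmin _ ?_
    convert! hmem (l + Pi.single i ε) (fun j => add_nonneg (hl j) ?_) using 1
    · simp [hp, add_smul, Finset.sum_add_distrib, Pi.single_apply, ite_smul]
    · by_cases hij : j = i
      · subst hij; simpa using hε
      · simp [hij]
  have hp0 : 0 ≤ inner ℝ (v - p) p := by
    have : inner ℝ (v - p) (-p) ≤ 0 := by
      refine inner_nonpos_of_forall_norm_sub_le fun ε _ hε => hmin _ ?_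
      convert! hmem (fun i => (1 - ε) * l i) (fun i => mul_nonneg (by linarith) (hl i)) using 1
      simp only [mul_smul, ← Finset.smul_sum, ← hp]
      module
    simpa using this
  obtain ⟨m, hm, ⟨j, hmj⟩, hpm⟩ :
      ∃ m : ι → ℝ, (∀ i, 0 ≤ m i) ∧ (∃ j, m j = 0) ∧ p = ∑ i, m i • x i := by
    by_cases hli : LinearIndependent ℝ x
    · refine ⟨l, hl, ?_, hp⟩
      by_contra! hne
      have hzero (i : ι) : inner ℝ (v - p) (x i) = 0 := by
        have hsum : 0 ≤ ∑ i, l i * inner ℝ (v - p) (x i) := by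
          rw [hp, inner_sum] at hp0
          simpa only [inner_smul_right, ← hp] using hp0
        have hterm (i : ι) : l i * inner ℝ (v - p) (x i) ≤ 0 :=
          mul_nonpos_of_nonneg_of_nonpos (hl i) (hxle i)
        have := (Finset.sum_eq_zero_iff_of_nonpos fun i _ => hterm i).1
          (le_antisymm (Finset.sum_nonpos fun i _ => hterm i) hsum) i (Finset.mem_univ i)
        exact (mul_eq_zero.1 this).resolve_left (hne i)
      have hspan : Submodule.span ℝ (Set.range x) = ⊤ :=
        hli.span_eq_top_of_card_eq_finrank' (le_antisymm hli.fintype_card_le_finrank hcard)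
      have hle : Submodule.span ℝ (Set.range x) ≤ (ℝ ∙ (v - p))ᗮ := by
        rw [Submodule.span_le]
        rintro _ ⟨i, rfl⟩
        exact Submodule.mem_orthogonal_singleton_iff_inner_right.2 (hzero i)
      rw [hspan] at hle
      exact hpv (inner_self_eq_zero.1 (Submodule.mem_orthogonal_singleton_iff_inner_right.1
        (hle (Submodule.mem_top (x := v - p)))))
    · rw [← linearIndepOn_univ_iff, ← Finset.coe_univ] at hli
      obtain ⟨m, hm, ⟨j, -, hj⟩, h⟩ := exists_nonneg_combination_eq_zero hli hl
      exact ⟨m, fun i => hm i (Finset.mem_univ i), ⟨j, hj⟩, hp.trans h⟩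
  have hnew (y : E) (hy : y ∈ t j) : inner ℝ (v - p) y ≤ 0 := by
    refine inner_nonpos_of_forall_norm_sub_le fun ε hε _ => hmin _ ?_
    refine Set.mem_iUnion₂.2 ⟨Function.update x j y, ?_, Function.update m j ε, fun i => ?_, ?_⟩
    · refine Fintype.mem_piFinset.2 fun i => ?_
      by_cases hij : i = j
      · subst hij; simpa using hy
      · simpa [hij] using Fintype.mem_piFinset.1 hx i
    · by_cases hij : i = j
      · subst hij; simpa using hε
      · simpa [hij] using hm i
    · rw [hpm, ← Finset.add_sum_erase _ _ (Finset.mem_univ j),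
        ← Finset.add_sum_erase _ _ (Finset.mem_univ j), hmj, zero_smul, zero_add, add_comm]
      simp only [Function.update_self]
      congr 1
      refine Finset.sum_congr rfl fun i hi => ?_
      simp [Finset.ne_of_mem_erase hi]
  have hvle : inner ℝ (v - p) v ≤ 0 :=
    convexHull_min (t := {y | inner ℝ (v - p) y ≤ 0}) hnew
      (convex_halfSpace_le (innerₛₗ ℝ (v - p)).isLinear 0) (hvt j)
  have hself : inner ℝ (v - p) (v - p) ≤ 0 := by
    rw [inner_sub_right]
    linarith
  exact hpv (real_inner_self_nonpos.1 hself)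

/-- Claim inside the proof of Lemma 2.6: if `X_1, …, X_d ⊆ ℝ^d` are sets whose convex
hulls each contain the ball `B_r(0)` with `r > 0`, then the simplicial cones spanned by
colorful choices `x_1 ∈ X_1, …, x_d ∈ X_d` cover `ℝ^d`: every `v ∈ ℝ^d` is a nonnegative
combination of some colorful choice of points. -/
theorem colorful_cones_cover
    (d : ℕ) (hd : 0 < d) (r : ℝ) (hr : 0 < r)
    (X : Fin d → Set (EuclideanSpace ℝ (Fin d)))
    (hX : ∀ i, Metric.closedBall (0 : EuclideanSpace ℝ (Fin d)) r ⊆ convexHull ℝ (X i)) :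
    ∀ v : EuclideanSpace ℝ (Fin d),
      ∃ (x : Fin d → EuclideanSpace ℝ (Fin d)) (l : Fin d → ℝ),
        (∀ i, x i ∈ X i) ∧ (∀ i, 0 ≤ l i) ∧ v = ∑ i, l i • x i := by
  intro v
  obtain ⟨ε, hε, hεv⟩ : ∃ ε : ℝ, 0 < ε ∧ ‖ε • v‖ ≤ r := by
    refine ⟨r / (‖v‖ + 1), by positivity, ?_⟩
    rw [norm_smul, Real.norm_of_nonneg (by positivity), div_mul_eq_mul_div,
      div_le_iff₀ (by positivity)]
    nlinarith [norm_nonneg v]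
  obtain ⟨x, l, hx, hl, h⟩ := exists_colorful_nonneg_combination (by simp) X
    fun i => hX i (mem_closedBall_zero_iff.2 hεv)
  refine ⟨x, fun i => ε⁻¹ * l i, hx, fun i => mul_nonneg (inv_nonneg.2 hε.le) (hl i), ?_⟩
  simp only [mul_smul, ← Finset.smul_sum, ← h]
  rw [inv_smul_smul₀ hε.ne']
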